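/- arXiv:2010.05548 — 6 statements merged into one kernel-verified Lean document; each statement's English description precedes it below -/
import Mathlib

section
/- Let H be a symmetric bilinear form on V satisfying the parallel-tensor identity H(R(X,Y)Z,W) + H(Z,R(X,Y)W) = 0 for all X,Y,Z,W ∈ V. Assume the s×s matrix (F_{ij}) is invertible. Then H is a linear combination of the inner product and the products of the 1-forms η^i: there exist a real number a and real numbers c_{αβ} (α,β = 1,…,s) such that H(X,Z) = a⟨X,Z⟩ + Σ_{α,β=1}^s c_{αβ} η^α(X) η^β(Z) for all X,Z ∈ V. -/
open Finset

local notation "⟪" x ", " y "⟫" => @inner ℝ _ _ x y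

/-- A second-order parallel symmetric tensor on a generalized
f.pk-space form (with invertible matrix `F = (F_{ij})`) is a linear combination
of the metric and the products of the 1-forms `η^i`. -/
theorem symm_parallel_tensor_generalized_fpk_space_form
    {V : Type*} [NormedAddCommGroup V] [InnerProductSpace ℝ V]
    [FiniteDimensional ℝ V]
    (n s : ℕ) (hn : 0 < n) (hs : 0 < s)
    (hdim : Module.finrank ℝ V = 2 * n + s)
    (φ : V →ₗ[ℝ] V) (ξ : Fin s → V) (η : Fin s → V →ₗ[ℝ] ℝ)
    (hφφ : ∀ X : V, φ (φ X) = -X + ∑ i, η i X • ξ i)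
    (hηξ : ∀ i j, η i (ξ j) = if i = j then (1 : ℝ) else 0)
    (hφξ : ∀ i, φ (ξ i) = 0)
    (hηφ : ∀ i (X : V), η i (φ X) = 0)
    (hmet : ∀ X Y : V, ⟪φ X, φ Y⟫ = ⟪X, Y⟫ - ∑ i, η i X * η i Y)
    (F₁ F₂ : ℝ) (F : Matrix (Fin s) (Fin s) ℝ) (hF : IsUnit F)
    (R : V → V → V → V)
    (hR : ∀ X Y Z : V, R X Y Z =
      F₁ • (⟪φ X, φ Z⟫ • φ (φ Y) - ⟪φ Y, φ Z⟫ • φ (φ X))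
      + F₂ • (⟪Z, φ Y⟫ • φ X - ⟪Z, φ X⟫ • φ Y + (2 * ⟪X, φ Y⟫) • φ Z)
      + ∑ i, ∑ j, F i j •
          ((η i X * η j Z) • φ (φ Y) - (η i Y * η j Z) • φ (φ X)
            + (⟪φ Y, φ Z⟫ * η i X) • ξ j - (⟪φ X, φ Z⟫ * η i Y) • ξ j))
    (H : V →ₗ[ℝ] V →ₗ[ℝ] ℝ)
    (hHsym : ∀ X Y : V, H X Y = H Y X)
    (hpar : ∀ X Y Z W : V, H (R X Y Z) W + H Z (R X Y W) = 0) :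
    ∃ (a : ℝ) (c : Fin s → Fin s → ℝ),
      ∀ X Z : V, H X Z = a * ⟪X, Z⟫ + ∑ α, ∑ β, c α β * η α X * η β Z := by
  have hRξ : ∀ (k : Fin s) (X Z : V),
      R X (ξ k) Z = -∑ j, F k j • (η j Z • φ (φ X) + ⟪φ X, φ Z⟫ • ξ j) := by
    intro k X Z
    rw [hR, Finset.sum_eq_single k (fun i _ hik => by simp [hφξ, hηξ, hik]) (by simp)]
    simp only [hφξ, hηξ, map_zero, inner_zero_left, inner_zero_right, ← Finset.sum_neg_distrib]
    simp only [smul_zero, zero_smul, mul_zero, zero_mul, sub_zero, add_zero, zero_add, if_true,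
      one_mul, mul_one, zero_sub]
    refine Finset.sum_congr rfl fun j _ => ?_
    module
  -- Invertibility of `F` separates the identity for `R X (ξ k)` into one identity for each `j`.
  have key : ∀ (j : Fin s) (X Z W : V),
      η j Z * H (φ (φ X)) W + ⟪φ X, φ Z⟫ * H (ξ j) W
        + η j W * H Z (φ (φ X)) + ⟪φ X, φ W⟫ * H Z (ξ j) = 0 := by
    intro j X Z W
    have hmul : F.mulVec (fun j => η j Z * H (φ (φ X)) W + ⟪φ X, φ Z⟫ * H (ξ j) W
        + η j W * H Z (φ (φ X)) + ⟪φ X, φ W⟫ * H Z (ξ j)) = F.mulVec 0 := by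
      ext k
      have h := hpar X (ξ k) Z W
      simp only [hRξ, map_neg, map_sum, map_smul, map_add, LinearMap.neg_apply,
        LinearMap.sum_apply, LinearMap.smul_apply, LinearMap.add_apply, smul_eq_mul] at h
      rw [Matrix.mulVec_zero, Pi.zero_apply, Matrix.mulVec, dotProduct, ← neg_eq_zero, ← h,
        ← neg_add, ← Finset.sum_add_distrib]
      congr 1
      exact Finset.sum_congr rfl fun j _ => by ring
    exact congrFun (Matrix.mulVec_injective_of_isUnit hF hmul) j
  have hmixed : ∀ (k : Fin s) (X : V), H (φ (φ X)) (ξ k) = 0 := by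
    intro k X
    have h := key k X (ξ k) (ξ k)
    simp only [hηξ, hφξ, inner_zero_right, if_true, hHsym (ξ k) (φ (φ X))] at h
    linarith
  have hξ : ∀ (k : Fin s) (Z : V), H Z (ξ k) = ∑ i, η i Z * H (ξ i) (ξ k) := by
    intro k Z
    have h := hmixed k Z
    simp only [hφφ, map_add, map_neg, map_sum, map_smul, LinearMap.add_apply,
      LinearMap.neg_apply, LinearMap.sum_apply, LinearMap.smul_apply, smul_eq_mul] at h
    linarith
  let k₀ : Fin s := ⟨0, hs⟩
  refine ⟨H (ξ k₀) (ξ k₀), fun α β => H (ξ α) (ξ β) - if α = β then H (ξ k₀) (ξ k₀) else 0,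
    fun X Z => ?_⟩
  have h := key k₀ Z X (ξ k₀)
  simp only [hmixed, hηξ, hφξ, inner_zero_right, if_true, hmet] at h
  simp only [hφφ, map_add, map_neg, map_sum, map_smul, smul_eq_mul, hξ _ X] at h
  have hexpand : ∑ α, ∑ β, (H (ξ α) (ξ β) - if α = β then H (ξ k₀) (ξ k₀) else 0)
        * η α X * η β Z
      = ∑ i, η i Z * ∑ j, η j X * H (ξ j) (ξ i)
        - H (ξ k₀) (ξ k₀) * ∑ i, η i Z * η i X := by
    simp only [sub_mul, Finset.sum_sub_distrib, ite_mul, zero_mul, Finset.sum_ite_eq,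
      Finset.mem_univ, if_true, Finset.mul_sum]
    rw [Finset.sum_comm]
    congr 1
    · exact Finset.sum_congr rfl fun _ _ => Finset.sum_congr rfl fun _ _ => by ring
    · exact Finset.sum_congr rfl fun _ _ => by ring
  rw [hexpand, real_inner_comm]
  linarith
end

section
/- Let H be a symmetric bilinear form on V satisfying the parallel-tensor identity H(R(X,Y)Z,W) + H(Z,R(X,Y)W) = 0 for all X,Y,Z,W ∈ V. If for indices k, r ∈ {1,…,s} one has F_{kr} ≠ 0, then H(X, ξ_r) = Σ_{α=1}^s η^α(X) H(ξ_α, ξ_r) for all X ∈ V (equivalently, H(φ²X, ξ_r) = 0 for all X ∈ V). -/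
open Finset

local notation "⟪" x ", " y "⟫" => @inner ℝ _ _ x y

/-- For a symmetric parallel tensor `H` on a generalized
f.pk-space form, if `F k r ≠ 0` then `H(X, ξ_r) = Σ_α η^α(X) H(ξ_α, ξ_r)`. -/
theorem symm_parallel_tensor_on_structure_vectors
    {V : Type*} [NormedAddCommGroup V] [InnerProductSpace ℝ V]
    [FiniteDimensional ℝ V]
    (n s : ℕ) (hn : 0 < n) (hs : 0 < s)
    (hdim : Module.finrank ℝ V = 2 * n + s)
    (φ : V →ₗ[ℝ] V) (ξ : Fin s → V) (η : Fin s → V →ₗ[ℝ] ℝ)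
    (hφφ : ∀ X : V, φ (φ X) = -X + ∑ i, η i X • ξ i)
    (hηξ : ∀ i j, η i (ξ j) = if i = j then (1 : ℝ) else 0)
    (hφξ : ∀ i, φ (ξ i) = 0)
    (hηφ : ∀ i (X : V), η i (φ X) = 0)
    (hmet : ∀ X Y : V, ⟪φ X, φ Y⟫ = ⟪X, Y⟫ - ∑ i, η i X * η i Y)
    (F₁ F₂ : ℝ) (F : Matrix (Fin s) (Fin s) ℝ)
    (R : V → V → V → V)
    (hR : ∀ X Y Z : V, R X Y Z =
      F₁ • (⟪φ X, φ Z⟫ • φ (φ Y) - ⟪φ Y, φ Z⟫ • φ (φ X))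
      + F₂ • (⟪Z, φ Y⟫ • φ X - ⟪Z, φ X⟫ • φ Y + (2 * ⟪X, φ Y⟫) • φ Z)
      + ∑ i, ∑ j, F i j •
          ((η i X * η j Z) • φ (φ Y) - (η i Y * η j Z) • φ (φ X)
            + (⟪φ Y, φ Z⟫ * η i X) • ξ j - (⟪φ X, φ Z⟫ * η i Y) • ξ j))
    (H : V →ₗ[ℝ] V →ₗ[ℝ] ℝ)
    (hHsym : ∀ X Y : V, H X Y = H Y X)
    (hpar : ∀ X Y Z W : V, H (R X Y Z) W + H Z (R X Y W) = 0)
    (k r : Fin s) (hkr : F k r ≠ 0) :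
    ∀ X : V, H X (ξ r) = ∑ α, η α X * H (ξ α) (ξ r) := by
  have inner_ξ_φ : ∀ i (Y : V), ⟪ξ i, φ Y⟫ = 0 := by
    intro i Y
    have h := hmet (ξ i) (φ Y)
    simpa [hφξ, hηφ] using h.symm
  have R_ξ_ξ : ∀ Y : V, R (ξ k) Y (ξ r) = F k r • φ (φ Y) := by
    intro Y
    simp [hR, hφξ, inner_ξ_φ, hηξ]
  intro X
  have hX : H (φ (φ X)) (ξ r) = 0 := by
    have h := hpar (ξ k) X (ξ r) (ξ r)
    rw [R_ξ_ξ, hHsym (ξ r), ← two_mul] at h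
    simpa [hkr] using h
  rw [hφφ] at hX
  simp only [map_add, map_neg, map_sum, map_smul, LinearMap.add_apply, LinearMap.neg_apply,
    LinearMap.sum_apply, LinearMap.smul_apply, smul_eq_mul] at hX
  linarith
end

section
/- Suppose s = 1 (so the structure consists of a single vector ξ and single 1-form η, and the matrix 𝓕 is a single real number F₁₁ with F₁₁ ≠ 0). If H is a symmetric bilinear form on V satisfying the parallel-tensor identity H(R(X,Y)Z,W) + H(Z,R(X,Y)W) = 0 for all X,Y,Z,W ∈ V, then H is proportional to the inner product: H(X,Z) = H(ξ,ξ)·⟨X,Z⟩ for all X,Z ∈ V. -/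
open Finset

local notation "⟪" x ", " y "⟫" => @inner ℝ _ _ x y

/-- For `s = 1` with `F₁₁ ≠ 0`, a symmetric parallel tensor on
a generalized Sasakian space form is proportional to the metric:
`H(X,Z) = H(ξ,ξ)⟨X,Z⟩`. -/
theorem symm_parallel_tensor_s_eq_one
    {V : Type*} [NormedAddCommGroup V] [InnerProductSpace ℝ V]
    [FiniteDimensional ℝ V]
    (n : ℕ) (hn : 0 < n)
    (hdim : Module.finrank ℝ V = 2 * n + 1)
    (φ : V →ₗ[ℝ] V) (ξ : V) (η : V →ₗ[ℝ] ℝ)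
    (hφφ : ∀ X : V, φ (φ X) = -X + η X • ξ)
    (hηξ : η ξ = 1)
    (hφξ : φ ξ = 0)
    (hηφ : ∀ X : V, η (φ X) = 0)
    (hmet : ∀ X Y : V, ⟪φ X, φ Y⟫ = ⟪X, Y⟫ - η X * η Y)
    (F₁ F₂ F₁₁ : ℝ) (hF : F₁₁ ≠ 0)
    (R : V → V → V → V)
    (hR : ∀ X Y Z : V, R X Y Z =
      F₁ • (⟪φ X, φ Z⟫ • φ (φ Y) - ⟪φ Y, φ Z⟫ • φ (φ X))
      + F₂ • (⟪Z, φ Y⟫ • φ X - ⟪Z, φ X⟫ • φ Y + (2 * ⟪X, φ Y⟫) • φ Z)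
      + F₁₁ • ((η X * η Z) • φ (φ Y) - (η Y * η Z) • φ (φ X)
            + (⟪φ Y, φ Z⟫ * η X) • ξ - (⟪φ X, φ Z⟫ * η Y) • ξ))
    (H : V →ₗ[ℝ] V →ₗ[ℝ] ℝ)
    (hHsym : ∀ X Y : V, H X Y = H Y X)
    (hpar : ∀ X Y Z W : V, H (R X Y Z) W + H Z (R X Y W) = 0) :
    ∀ X Z : V, H X Z = H ξ ξ * ⟪X, Z⟫ := by
  have inner_ξ (Y : V) : ⟪ξ, Y⟫ = η Y := by
    have h := hmet ξ Y
    rw [hφξ, inner_zero_left, hηξ] at h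
    linarith
  have R_ξ (Y Z : V) : R ξ Y Z = F₁₁ • (⟪Y, Z⟫ • ξ - η Z • Y) := by
    rw [hR, hφξ, inner_ξ, hηφ, hmet, hφφ, hηξ]
    simp only [map_zero, inner_zero_left, inner_zero_right]
    module
  have hpar_ξ (Y Z W : V) :
      ⟪Y, Z⟫ * H ξ W - η Z * H Y W + (⟪Y, W⟫ * H Z ξ - η W * H Z Y) = 0 := by
    have h := hpar ξ Y Z W
    simp only [R_ξ, map_smul, map_sub, LinearMap.smul_apply, LinearMap.sub_apply,
      smul_eq_mul] at h
    rw [← mul_add] at h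
    exact (mul_eq_zero.mp h).resolve_left hF
  have H_ξ (Y : V) : H ξ Y = η Y * H ξ ξ := by
    have h := hpar_ξ Y ξ ξ
    rw [real_inner_comm, inner_ξ, hηξ, hHsym Y ξ] at h
    linarith
  intro X Z
  have h := hpar_ξ X ξ Z
  rw [real_inner_comm, inner_ξ, hηξ, H_ξ Z, H_ξ X] at h
  linarith
end

section
/- Let H be a skew-symmetric bilinear form on V satisfying the parallel-tensor identity H(R(X,Y)Z,W) + H(Z,R(X,Y)W) = 0 for all X,Y,Z,W ∈ V. Assume the s×s matrix (F_{ij}) is invertible. Then H = 0; i.e., there is no non-zero second order parallel skew-symmetric tensor on a generalized f.pk-space form. -/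
open Finset

local notation "⟪" x ", " y "⟫" => @inner ℝ _ _ x y

/-- There is no non-zero second order parallel skew-symmetric
tensor on a generalized f.pk-space form (with invertible matrix `(F_{ij})`). -/
theorem no_nonzero_skew_parallel_tensor
    {V : Type*} [NormedAddCommGroup V] [InnerProductSpace ℝ V]
    [FiniteDimensional ℝ V]
    (n s : ℕ) (hn : 0 < n) (hs : 0 < s)
    (hdim : Module.finrank ℝ V = 2 * n + s)
    (φ : V →ₗ[ℝ] V) (ξ : Fin s → V) (η : Fin s → V →ₗ[ℝ] ℝ)
    (hφφ : ∀ X : V, φ (φ X) = -X + ∑ i, η i X • ξ i)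
    (hηξ : ∀ i j, η i (ξ j) = if i = j then (1 : ℝ) else 0)
    (hφξ : ∀ i, φ (ξ i) = 0)
    (hηφ : ∀ i (X : V), η i (φ X) = 0)
    (hmet : ∀ X Y : V, ⟪φ X, φ Y⟫ = ⟪X, Y⟫ - ∑ i, η i X * η i Y)
    (F₁ F₂ : ℝ) (F : Matrix (Fin s) (Fin s) ℝ)
    (R : V → V → V → V)
    (hR : ∀ X Y Z : V, R X Y Z =
      F₁ • (⟪φ X, φ Z⟫ • φ (φ Y) - ⟪φ Y, φ Z⟫ • φ (φ X))
      + F₂ • (⟪Z, φ Y⟫ • φ X - ⟪Z, φ X⟫ • φ Y + (2 * ⟪X, φ Y⟫) • φ Z)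
      + ∑ i, ∑ j, F i j •
          ((η i X * η j Z) • φ (φ Y) - (η i Y * η j Z) • φ (φ X)
            + (⟪φ Y, φ Z⟫ * η i X) • ξ j - (⟪φ X, φ Z⟫ * η i Y) • ξ j))
    (hF : IsUnit F)
    (H : V →ₗ[ℝ] V →ₗ[ℝ] ℝ)
    (hHskew : ∀ X Y : V, H X Y = -H Y X)
    (hpar : ∀ X Y Z W : V, H (R X Y Z) W + H Z (R X Y W) = 0) :
    ∀ X Y : V, H X Y = 0 := by
  have hφξ_inner : ∀ i X, ⟪φ X, ξ i⟫ = 0 := by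
    intro i X
    have h := hmet (φ X) (ξ i)
    simpa [hφξ, hηφ] using h.symm
  have hφφ_inner : ∀ X Y, ⟪φ (φ X), φ Y⟫ = ⟪φ X, Y⟫ := by
    intro X Y
    simpa [hηφ] using hmet (φ X) Y
  have hφφφ : ∀ X, φ (φ (φ X)) = -φ X := by
    intro X
    simpa [hηφ] using hφφ (φ X)
  have hskew : ∀ X, ⟪φ (φ X), φ X⟫ = 0 := by
    intro X
    have h := hφφ_inner (φ X) (φ X)
    rw [hφφφ, inner_neg_left, real_inner_comm] at h
    linarith
  have hself : ∀ X, H X X = 0 := fun X => by linarith [hHskew X X]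
  have hR_horizontal : ∀ a X Z, R (φ X) (ξ a) Z =
      ∑ j, F a j • (η j Z • φ X - ⟪φ X, Z⟫ • ξ j) := by
    intro a X Z
    rw [hR, Finset.sum_eq_single a]
    · simp [hφξ, hηξ, hηφ, hφφφ, hφφ_inner, sub_eq_add_neg]
    · intro i _ hi
      simp [hφξ, hηξ, hηφ, hi]
    · simp
  have key : ∀ j X Z W, η j Z * H (φ X) W - ⟪φ X, Z⟫ * H (ξ j) W
      + (η j W * H Z (φ X) - ⟪φ X, W⟫ * H Z (ξ j)) = 0 := by
    intro j X Z W
    let K : Fin s → ℝ := fun j => η j Z * H (φ X) W - ⟪φ X, Z⟫ * H (ξ j) W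
      + (η j W * H Z (φ X) - ⟪φ X, W⟫ * H Z (ξ j))
    have hK : F.mulVec K = F.mulVec 0 := by
      ext a
      have h := hpar (φ X) (ξ a) Z W
      rw [hR_horizontal, hR_horizontal] at h
      simp only [map_sum, map_smul, map_sub, LinearMap.sum_apply, LinearMap.smul_apply,
        LinearMap.sub_apply, smul_eq_mul, ← Finset.sum_add_distrib, ← mul_add] at h
      simpa [Matrix.mulVec, dotProduct, K] using h
    exact congrFun (Matrix.mulVec_injective_iff_isUnit.mpr hF hK) j
  have hHφφ : ∀ X Y, H (φ X) (φ Y) = 0 := by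
    intro X Y
    have h := key ⟨0, hs⟩ X (ξ ⟨0, hs⟩) (φ Y)
    simpa [hηξ, hηφ, hφξ_inner, hself] using h
  have hHξφ : ∀ j X, H (ξ j) (φ X) = 0 := by
    intro j X
    by_cases hX : φ X = 0
    · simp [hX]
    have h := key j (φ X) (φ (φ X)) (φ X)
    rw [hskew, hφφ_inner X (φ X)] at h
    simpa [hηφ, hX] using h
  obtain ⟨E, hE⟩ : ∃ E, φ E ≠ 0 := by
    by_contra! h
    have hspan : Submodule.span ℝ (Set.range ξ) = ⊤ := by
      refine eq_top_iff.mpr fun X _ => ?_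
      have hX : X = ∑ i, η i X • ξ i := by
        have := hφφ X
        rw [h, eq_comm, neg_add_eq_zero] at this
        exact this
      rw [hX]
      exact Submodule.sum_mem _ fun i _ =>
        Submodule.smul_mem _ _ (Submodule.subset_span ⟨i, rfl⟩)
    have hle := finrank_range_le_card (R := ℝ) ξ
    rw [Set.finrank, hspan, finrank_top, hdim, Fintype.card_fin] at hle
    omega
  have hHξξ : ∀ j k, H (ξ j) (ξ k) = 0 := by
    intro j k
    have h := key j E (φ E) (ξ k)
    simpa [hηφ, hHφφ, hφξ_inner, hE] using h
  have hHφξ : ∀ X j, H (φ X) (ξ j) = 0 := fun X j => by rw [hHskew, hHξφ, neg_zero]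
  have hdecomp : ∀ X, X = -φ (φ X) + ∑ i, η i X • ξ i := fun X => by
    rw [hφφ]; abel
  intro X Y
  rw [hdecomp X, hdecomp Y]
  simp [hHφφ, hHξφ, hHφξ, hHξξ]
end

section
/- Let H be a skew-symmetric bilinear form on V satisfying the parallel-tensor identity H(R(X,Y)Z,W) + H(Z,R(X,Y)W) = 0 for all X,Y,Z,W ∈ V. Assume the s×s matrix (F_{ij}) is invertible. Then H(X, ξ_k) = 0 for every X ∈ V and every k ∈ {1,…,s}. -/
open Finset

local notation "⟪" x ", " y "⟫" => @inner ℝ _ _ x y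

/-- A skew-symmetric parallel tensor on a generalized
f.pk-space form (with invertible matrix `(F_{ij})`) annihilates the structure
vector fields: `H(X, ξ_k) = 0`. -/
theorem skew_parallel_tensor_kills_structure_vectors
    {V : Type*} [NormedAddCommGroup V] [InnerProductSpace ℝ V]
    [FiniteDimensional ℝ V]
    (n s : ℕ) (hn : 0 < n) (hs : 0 < s)
    (hdim : Module.finrank ℝ V = 2 * n + s)
    (φ : V →ₗ[ℝ] V) (ξ : Fin s → V) (η : Fin s → V →ₗ[ℝ] ℝ)
    (hφφ : ∀ X : V, φ (φ X) = -X + ∑ i, η i X • ξ i)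
    (hηξ : ∀ i j, η i (ξ j) = if i = j then (1 : ℝ) else 0)
    (hφξ : ∀ i, φ (ξ i) = 0)
    (hηφ : ∀ i (X : V), η i (φ X) = 0)
    (hmet : ∀ X Y : V, ⟪φ X, φ Y⟫ = ⟪X, Y⟫ - ∑ i, η i X * η i Y)
    (F₁ F₂ : ℝ) (F : Matrix (Fin s) (Fin s) ℝ)
    (R : V → V → V → V)
    (hR : ∀ X Y Z : V, R X Y Z =
      F₁ • (⟪φ X, φ Z⟫ • φ (φ Y) - ⟪φ Y, φ Z⟫ • φ (φ X))
      + F₂ • (⟪Z, φ Y⟫ • φ X - ⟪Z, φ X⟫ • φ Y + (2 * ⟪X, φ Y⟫) • φ Z)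
      + ∑ i, ∑ j, F i j •
          ((η i X * η j Z) • φ (φ Y) - (η i Y * η j Z) • φ (φ X)
            + (⟪φ Y, φ Z⟫ * η i X) • ξ j - (⟪φ X, φ Z⟫ * η i Y) • ξ j))
    (hF : IsUnit F)
    (H : V →ₗ[ℝ] V →ₗ[ℝ] ℝ)
    (hHskew : ∀ X Y : V, H X Y = -H Y X)
    (hpar : ∀ X Y Z W : V, H (R X Y Z) W + H Z (R X Y W) = 0) :
    ∀ (X : V) (k : Fin s), H X (ξ k) = 0 := by
  have inner_ξ : ∀ a (Y : V), ⟪ξ a, Y⟫ = η a Y := by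
    intro a Y
    have h := hmet (ξ a) Y
    simp only [hφξ, inner_zero_left, hηξ, ite_mul, one_mul, zero_mul,
      Finset.sum_ite_eq', Finset.mem_univ, if_true] at h
    linarith
  have φ_cube : ∀ U, φ (φ (φ U)) = -φ U := by
    intro U
    simp [hφφ (φ U), hηφ]
  have inner_φφ : ∀ U T, ⟪φ (φ U), φ (φ T)⟫ = ⟪φ U, φ T⟫ := by
    intro U T
    simp [hmet (φ U) (φ T), hηφ]
  have R_ξ : ∀ a U Z, R (ξ a) (φ U) Z =
      ∑ j, F a j • (⟪φ (φ U), φ Z⟫ • ξ j - η j Z • φ U) := by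
    intro a U Z
    rw [hR, Finset.sum_eq_single a]
    · simp only [hφξ, inner_ξ, hηφ, φ_cube, hηξ, inner_zero_left, inner_zero_right]
      simp only [if_true, zero_smul, smul_zero, map_zero, mul_zero, zero_mul, sub_zero,
        add_zero, neg_zero, zero_add, one_mul, mul_one, smul_neg, neg_add_eq_sub]
    · intro i _ hi
      simp [hηξ, hi, hηφ]
    · simp
  have R_ξ_φ : ∀ a U T, R (ξ a) (φ U) (φ T) = ⟪φ U, φ T⟫ • ∑ j, F a j • ξ j := by
    intro a U T
    rw [R_ξ, Finset.smul_sum]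
    refine Finset.sum_congr rfl fun j _ => ?_
    rw [inner_φφ, hηφ, zero_smul, sub_zero, smul_comm]
  have R_ξ_ξ : ∀ a U c, R (ξ a) (φ U) (ξ c) = -(F a c • φ U) := by
    intro a U c
    rw [R_ξ, Finset.sum_eq_single c]
    · simp [hφξ, hηξ]
    · intro j _ hj
      simp [hφξ, hηξ, hj]
    · simp
  obtain ⟨U, hU⟩ : ∃ U, φ U ≠ 0 := by
    by_contra! h
    have hspan : Submodule.span ℝ (Set.range ξ) = ⊤ := by
      refine Submodule.eq_top_iff'.2 fun X => ?_
      have hX : X = ∑ i, η i X • ξ i := by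
        have := hφφ X
        rw [h, neg_add_eq_sub, eq_comm, sub_eq_zero] at this
        exact this.symm
      rw [hX]
      exact Submodule.sum_mem _ fun i _ =>
        Submodule.smul_mem _ _ (Submodule.subset_span ⟨i, rfl⟩)
    have hle := finrank_range_le_card (R := ℝ) ξ
    rw [Set.finrank, hspan, finrank_top, hdim, Fintype.card_fin] at hle
    omega
  have inner_pos : ∀ T, φ T ≠ 0 → ⟪φ T, φ T⟫ ≠ 0 := fun T hT => inner_self_ne_zero.2 hT
  have H_self : ∀ X, H X X = 0 := fun X => by linarith [hHskew X X]
  have of_combination : ∀ W, (∀ a, H (∑ j, F a j • ξ j) W = 0) → ∀ k, H (ξ k) W = 0 := by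
    intro W hW k
    have hz : F.mulVec (fun j => H (ξ j) W) = F.mulVec 0 := by
      ext a
      simpa [Matrix.mulVec, dotProduct] using hW a
    exact congrFun (Matrix.mulVec_injective_of_isUnit hF hz) k
  have H_ξ_ξ : ∀ c k, H (ξ k) (ξ c) = 0 := by
    intro c
    refine of_combination _ fun a => ?_
    have h := hpar (ξ a) (φ U) (φ U) (ξ c)
    rw [R_ξ_φ, R_ξ_ξ, map_neg, map_smul, LinearMap.smul_apply, map_smul, H_self,
      smul_zero, neg_zero, add_zero, smul_eq_mul] at h
    exact (mul_eq_zero.1 h).resolve_left (inner_pos U hU)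
  have H_ξ_φ : ∀ T k, H (ξ k) (φ T) = 0 := by
    intro T
    refine of_combination _ fun a => ?_
    by_cases hT : φ T = 0
    · rw [hT, map_zero]
    have horth : ⟪φ (φ T), φ T⟫ = 0 := by
      have h := inner_φφ (φ T) T
      rw [φ_cube, inner_neg_left, real_inner_comm] at h
      linarith
    have h := hpar (ξ a) (φ (φ T)) (φ (φ T)) (φ T)
    rw [R_ξ_φ, R_ξ_φ, horth, inner_φφ, zero_smul, map_zero, add_zero, map_smul,
      LinearMap.smul_apply, smul_eq_mul] at h
    exact (mul_eq_zero.1 h).resolve_left (inner_pos T hT)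
  intro X k
  have hX : X = ∑ i, η i X • ξ i - φ (φ X) := by
    rw [hφφ]
    abel
  rw [hHskew, hX, map_sub, H_ξ_φ, map_sum]
  simp [H_ξ_ξ]
end

section
/- Assume n ≥ 2. Let G ⊂ V be a linear subspace of codimension 1 containing all the structure vectors ξ_1,…,ξ_s, and let N be a unit vector orthogonal to G. Then it is impossible that ⟨Z,φY⟩⟨φX,N⟩ − ⟨Z,φX⟩⟨φY,N⟩ + 2⟨X,φY⟩⟨φZ,N⟩ = 0 for all X, Y, Z ∈ G. (This is the algebraic core of the theorem that a hypersurface of a generalized f.pk-space form M^{2n+s}(F₁,F₂,𝓕) tangent to the structure vector fields cannot be parallel when F₂ ≠ 0: by the Codazzi equation, parallelism forces the normal component F₂(⟨Z,φY⟩φX − ⟨Z,φX⟩φY + 2⟨X,φY⟩φZ)^⊥ to vanish, which gives exactly the displayed identity.) -/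
open Finset

local notation "⟪" x ", " y "⟫" => @inner ℝ _ _ x y

/-- A codimension-one subspace orthogonal to a unit vector contains every vector orthogonal
to that unit vector. -/
theorem mem_of_inner_eq_zero_of_finrank_add_one
    {V : Type*} [NormedAddCommGroup V] [InnerProductSpace ℝ V] [FiniteDimensional ℝ V]
    {G : Submodule ℝ V} (hG : Module.finrank ℝ G + 1 = Module.finrank ℝ V)
    {N : V} (hN : ‖N‖ = 1) (hNG : ∀ X ∈ G, ⟪N, X⟫ = 0) {X : V} (hX : ⟪N, X⟫ = 0) :
    X ∈ G := by
  have hle : G ≤ (ℝ ∙ N)ᗮ := fun Y hY =>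
    Submodule.mem_orthogonal_singleton_iff_inner_right.2 (hNG Y hY)
  have hN0 : N ≠ 0 := by
    rintro rfl
    simp at hN
  have hsum := (ℝ ∙ N).finrank_add_finrank_orthogonal
  rw [finrank_span_singleton hN0] at hsum
  rw [Submodule.eq_of_le_of_finrank_eq hle (by omega)]
  exact Submodule.mem_orthogonal_singleton_iff_inner_right.2 hX

/-- There is a nonzero common zero of `s` linear functionals orthogonal to two given vectors
when the dimension exceeds `s + 2`. -/
theorem exists_ne_zero_forall_eq_zero_inner_eq_zero
    {V : Type*} [NormedAddCommGroup V] [InnerProductSpace ℝ V] [FiniteDimensional ℝ V]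
    {s : ℕ} (hs : s + 2 < Module.finrank ℝ V) (η : Fin s → V →ₗ[ℝ] ℝ) (A B : V) :
    ∃ W : V, W ≠ 0 ∧ (∀ i, η i W = 0) ∧ ⟪A, W⟫ = 0 ∧ ⟪B, W⟫ = 0 := by
  let f : V →ₗ[ℝ] (Fin s → ℝ) × ℝ × ℝ :=
    (LinearMap.pi η).prod ((innerₛₗ ℝ A).prod (innerₛₗ ℝ B))
  have hker : LinearMap.ker f ≠ ⊥ := LinearMap.ker_ne_bot_of_finrank_lt (by simpa using hs)
  obtain ⟨W, hW, hW0⟩ := (Submodule.ne_bot_iff _).1 hker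
  obtain ⟨h₁, h₂⟩ := Prod.ext_iff.1 (LinearMap.mem_ker.1 hW)
  obtain ⟨h₃, h₄⟩ := Prod.ext_iff.1 h₂
  exact ⟨W, hW0, fun i => congrFun h₁ i, h₃, h₄⟩

/-- (Algebraic core of the non-existence of parallel
hypersurfaces tangent to the structure vector fields, for `F₂ ≠ 0`.)
If `n ≥ 2`, `G` is a codimension-one subspace containing all structure vectors
`ξ_i`, and `N` is a unit vector orthogonal to `G`, then the identity
`⟨Z,φY⟩⟨φX,N⟩ − ⟨Z,φX⟩⟨φY,N⟩ + 2⟨X,φY⟩⟨φZ,N⟩ = 0` cannot hold for all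
`X, Y, Z ∈ G`. -/
theorem no_parallel_hypersurface_core
    {V : Type*} [NormedAddCommGroup V] [InnerProductSpace ℝ V]
    [FiniteDimensional ℝ V]
    (n s : ℕ) (hn : 0 < n) (hs : 0 < s)
    (hdim : Module.finrank ℝ V = 2 * n + s)
    (φ : V →ₗ[ℝ] V) (ξ : Fin s → V) (η : Fin s → V →ₗ[ℝ] ℝ)
    (hφφ : ∀ X : V, φ (φ X) = -X + ∑ i, η i X • ξ i)
    (hηξ : ∀ i j, η i (ξ j) = if i = j then (1 : ℝ) else 0)
    (hφξ : ∀ i, φ (ξ i) = 0)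
    (hηφ : ∀ i (X : V), η i (φ X) = 0)
    (hmet : ∀ X Y : V, ⟪φ X, φ Y⟫ = ⟪X, Y⟫ - ∑ i, η i X * η i Y)
    (hn2 : 2 ≤ n)
    (G : Submodule ℝ V) (hG : Module.finrank ℝ G + 1 = Module.finrank ℝ V)
    (hξG : ∀ i, ξ i ∈ G)
    (N : V) (hN : ‖N‖ = 1) (hNG : ∀ X ∈ G, ⟪N, X⟫ = 0) :
    ¬ (∀ X ∈ G, ∀ Y ∈ G, ∀ Z ∈ G,
        ⟪Z, φ Y⟫ * ⟪φ X, N⟫ - ⟪Z, φ X⟫ * ⟪φ Y, N⟫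
          + 2 * ⟪X, φ Y⟫ * ⟪φ Z, N⟫ = 0) := by
  intro h
  have hη : ∀ i X, η i X = ⟪X, ξ i⟫ := by
    intro i X
    have := hmet X (ξ i)
    simp only [hφξ, inner_zero_right, hηξ, mul_ite, mul_one, mul_zero, sum_ite_eq',
      mem_univ, if_true] at this
    linarith
  have hskew : ∀ X Y, ⟪φ X, Y⟫ = -⟪X, φ Y⟫ := by
    intro X Y
    have := hmet (φ X) Y
    have hξφ : ∀ i, ⟪ξ i, φ Y⟫ = 0 := fun i => by
      rw [real_inner_comm, ← hη, hηφ]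
    simp only [hφφ, inner_add_left, inner_neg_left, sum_inner, real_inner_smul_left, hξφ,
      hηφ, mul_zero, zero_mul, sum_const_zero] at this
    linarith
  have hmem : ∀ X, ⟪N, X⟫ = 0 → X ∈ G := fun X hX =>
    mem_of_inner_eq_zero_of_finrank_add_one hG hN hNG hX
  have hηN : ∀ i, η i N = 0 := fun i => by rw [hη, hNG _ (hξG i)]
  have hφφN : φ (φ N) = -N := by simp [hφφ, hηN]
  have hNφN : ⟪N, φ N⟫ = 0 := by
    have := hskew N N
    rw [real_inner_comm] at this
    linarith
  obtain ⟨W, hW0, hηW, hNW, hφNW⟩ :=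
    exists_ne_zero_forall_eq_zero_inner_eq_zero (by omega) η N (φ N)
  have hφφW : φ (φ W) = -W := by simp [hφφ, hηW]
  have hNφW : ⟪N, φ W⟫ = 0 := by
    have := hskew N W
    linarith
  have key := h W (hmem W hNW) (φ W) (hmem _ hNφW) (φ N) (hmem _ hNφN)
  rw [hφφW, hφφN, real_inner_comm N (φ W), hNφW] at key
  simp only [inner_neg_left, inner_neg_right, real_inner_comm N W, hNW,
    real_inner_self_eq_norm_sq, hN] at key
  have := norm_pos_iff.2 hW0
  nlinarith
end
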